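/- arXiv:1104.1144 — 6 statements merged into one kernel-verified Lean document; each statement's English description precedes it below -/
import Mathlib

section
/- Suppose F_pure : {pure states of ℂ^d} → [0,∞) is a pure-state ensemble monotone, i.e. for every unit vector ψ and every U(1)-invariant pure-state ensemble operation {K_x} one has F_pure(ψ) ≥ Σ_{x : p_x>0} p_x F_pure(K_xψ/‖K_xψ‖) where p_x = ‖K_xψ‖². Then its convex-roof extension F is an ensemble monotone for all states: for every density matrix ρ ∈ M_d(ℂ), every finite family {K_j}_{j∈J} of number-shift Kraus operators with Σ_{j∈J} K_j†K_j = I, and every partition J = ⊔_{x∈X} J_x, setting p_x = Σ_{j∈J_x} Tr(K_j ρ K_j†) and σ_x = (1/p_x) Σ_{j∈J_x} K_j ρ K_j† for p_x > 0, one has F(ρ) ≥ Σ_{x : p_x>0} p_x F(σ_x). -/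
open Matrix Finset
open scoped ComplexOrder

noncomputable section

/-- Squared Euclidean norm of a vector in `ℂ^d`. -/
def nsq {d : ℕ} (ψ : Fin d → ℂ) : ℝ := ∑ n, ‖ψ n‖ ^ 2

/-- The rank-one projector `|ψ⟩⟨ψ|`, with entries `ψ m * conj (ψ n)`. -/
def pureProj {d : ℕ} (ψ : Fin d → ℂ) : Matrix (Fin d) (Fin d) ℂ :=
  Matrix.vecMulVec ψ (star ψ)

/-- A density matrix: positive semidefinite with trace one. -/
def IsDensityMatrix {d : ℕ} (ρ : Matrix (Fin d) (Fin d) ℂ) : Prop :=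
  ρ.PosSemidef ∧ ρ.trace = 1

/-- Convex-roof extension of a function defined on pure states (unit vectors). -/
def convexRoof {d : ℕ} (Fpure : (Fin d → ℂ) → ℝ) (ρ : Matrix (Fin d) (Fin d) ℂ) : ℝ :=
  sInf { r : ℝ | ∃ (m : ℕ) (q : Fin m → ℝ) (ψ : Fin m → Fin d → ℂ),
    (∀ i, 0 ≤ q i) ∧ (∑ i, q i = 1) ∧ (∀ i, nsq (ψ i) = 1) ∧
    ρ = ∑ i, q i • pureProj (ψ i) ∧ r = ∑ i, q i * Fpure (ψ i) }

/-- A number-shift Kraus operator: for some `ℓ : ℤ`, `K m n = 0` unless `m = n + ℓ`. -/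
def IsNumberShift {d : ℕ} (K : Matrix (Fin d) (Fin d) ℂ) : Prop :=
  ∃ ℓ : ℤ, ∀ m n : Fin d, (m : ℤ) ≠ (n : ℤ) + ℓ → K m n = 0

/-- `Fpure` is a pure-state ensemble monotone under U(1)-invariant operations:
for every unit vector `ψ` and every finite family of number-shift Kraus operators
`{K x}` with `∑ x, (K x)ᴴ * K x = 1`, the average of `Fpure` over the (normalized)
outcomes with positive probability does not exceed `Fpure ψ`. -/
def IsPureEnsembleMonotone {d : ℕ} (Fpure : (Fin d → ℂ) → ℝ) : Prop :=
  ∀ (ψ : Fin d → ℂ), nsq ψ = 1 →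
    ∀ (m : ℕ) (K : Fin m → Matrix (Fin d) (Fin d) ℂ),
      (∀ x, IsNumberShift (K x)) →
      (∑ x, (K x)ᴴ * K x = 1) →
      Fpure ψ ≥
        ∑ x ∈ Finset.univ.filter (fun x => 0 < nsq ((K x).mulVec ψ)),
          nsq ((K x).mulVec ψ) *
            Fpure ((Real.sqrt (nsq ((K x).mulVec ψ)))⁻¹ • (K x).mulVec ψ)

/-- The probability `p_x = ∑_{j ∈ J_x} Tr(K_j ρ K_j†)` of the coarse-grained outcome `x`,
where `J_x` is the fiber of the partition map `part` over `x`. -/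
def outProb {d mJ mX : ℕ} (K : Fin mJ → Matrix (Fin d) (Fin d) ℂ)
    (part : Fin mJ → Fin mX) (ρ : Matrix (Fin d) (Fin d) ℂ) (x : Fin mX) : ℝ :=
  ∑ j ∈ Finset.univ.filter (fun j => part j = x), ((K j * ρ * (K j)ᴴ).trace).re

/-- The normalized output state `σ_x = p_x⁻¹ ∑_{j ∈ J_x} K_j ρ K_j†`. -/
def outState {d mJ mX : ℕ} (K : Fin mJ → Matrix (Fin d) (Fin d) ℂ)
    (part : Fin mJ → Fin mX) (ρ : Matrix (Fin d) (Fin d) ℂ) (x : Fin mX) :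
    Matrix (Fin d) (Fin d) ℂ :=
  (outProb K part ρ x)⁻¹ •
    ∑ j ∈ Finset.univ.filter (fun j => part j = x), K j * ρ * (K j)ᴴ

lemma nsq_nonneg {d : ℕ} (v : Fin d → ℂ) : 0 ≤ nsq v :=
  Finset.sum_nonneg fun _ _ => by positivity

lemma eq_zero_of_not_nsq_pos {d : ℕ} {v : Fin d → ℂ} (h : ¬ 0 < nsq v) : v = 0 := by
  have h0 : nsq v = 0 := le_antisymm (not_lt.mp h) (nsq_nonneg v)
  have h1 := (Finset.sum_eq_zero_iff_of_nonneg (fun n _ => by positivity)).mp h0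
  funext n
  simpa using h1 n (Finset.mem_univ n)

lemma nsq_smul {d : ℕ} (c : ℝ) (v : Fin d → ℂ) : nsq (c • v) = c ^ 2 * nsq v := by
  simp [nsq, Finset.mul_sum, mul_pow]

lemma pureProj_smul {d : ℕ} (c : ℝ) (v : Fin d → ℂ) :
    pureProj (c • v) = c ^ 2 • pureProj v := by
  ext a b
  simp [pureProj, Matrix.vecMulVec_apply]
  ring

lemma trace_pureProj {d : ℕ} (v : Fin d → ℂ) : (pureProj v).trace = (nsq v : ℂ) := by
  simp [pureProj, Matrix.trace, Matrix.vecMulVec_apply, nsq, Complex.mul_conj, Complex.sq_norm]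

lemma mul_pureProj_mul_conjTranspose {d : ℕ} (K : Matrix (Fin d) (Fin d) ℂ) (v : Fin d → ℂ) :
    K * pureProj v * Kᴴ = pureProj (K.mulVec v) := by
  rw [pureProj, pureProj, Matrix.mul_vecMulVec, Matrix.vecMulVec_mul, Matrix.star_mulVec]

/-- The normalization of `v`, or the fallback value `w` when `v = 0`. -/
def unitize {d : ℕ} (w v : Fin d → ℂ) : Fin d → ℂ :=
  if 0 < nsq v then (Real.sqrt (nsq v))⁻¹ • v else w

lemma nsq_unitize {d : ℕ} {w : Fin d → ℂ} (hw : nsq w = 1) (v : Fin d → ℂ) :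
    nsq (unitize w v) = 1 := by
  unfold unitize
  split_ifs with h
  · rw [nsq_smul, inv_pow, Real.sq_sqrt h.le, inv_mul_cancel₀ h.ne']
  · exact hw

lemma nsq_smul_pureProj_unitize {d : ℕ} (w v : Fin d → ℂ) :
    nsq v • pureProj (unitize w v) = pureProj v := by
  unfold unitize
  split_ifs with h
  · rw [pureProj_smul, smul_smul, inv_pow, Real.sq_sqrt h.le, mul_inv_cancel₀ h.ne', one_smul]
  · simp [eq_zero_of_not_nsq_pos h, nsq, pureProj]

lemma convexRoof_le_sum {d : ℕ} {Fpure : (Fin d → ℂ) → ℝ}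
    (hF0 : ∀ ψ : Fin d → ℂ, nsq ψ = 1 → 0 ≤ Fpure ψ) {ι : Type*} [Fintype ι]
    {ρ : Matrix (Fin d) (Fin d) ℂ} {q : ι → ℝ} {ψ : ι → Fin d → ℂ}
    (hq : ∀ i, 0 ≤ q i) (hq1 : ∑ i, q i = 1) (hψ : ∀ i, nsq (ψ i) = 1)
    (hρ : ρ = ∑ i, q i • pureProj (ψ i)) :
    convexRoof Fpure ρ ≤ ∑ i, q i * Fpure (ψ i) := by
  apply csInf_le
  · refine ⟨0, ?_⟩
    rintro _ ⟨m, q, ψ, hq, -, hψ, -, rfl⟩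
    exact Finset.sum_nonneg fun i _ => mul_nonneg (hq i) (hF0 _ (hψ i))
  · let e := (Fintype.equivFin ι).symm
    exact ⟨Fintype.card ι, q ∘ e, ψ ∘ e, fun i => hq _, (e.sum_comp q).trans hq1, fun i => hψ _,
      hρ.trans (e.sum_comp fun i => q i • pureProj (ψ i)).symm,
      (e.sum_comp fun i => q i * Fpure (ψ i)).symm⟩

lemma IsDensityMatrix.exists_decomposition {d : ℕ} (hd : 1 ≤ d)
    {ρ : Matrix (Fin d) (Fin d) ℂ} (hρ : IsDensityMatrix ρ) :
    ∃ (q : Fin d → ℝ) (ψ : Fin d → Fin d → ℂ), (∀ i, 0 ≤ q i) ∧ ∑ i, q i = 1 ∧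
      (∀ i, nsq (ψ i) = 1) ∧ ρ = ∑ i, q i • pureProj (ψ i) := by
  obtain ⟨hpos, htr⟩ := hρ
  obtain ⟨B, hB⟩ : ∃ B : Matrix (Fin d) (Fin d) ℂ, ρ = Bᴴ * B := by
    open scoped MatrixOrder in
    exact CStarAlgebra.nonneg_iff_eq_star_mul_self.mp hpos.nonneg
  have hsum : ρ = ∑ i, pureProj (fun n => star (B i n)) := by
    rw [hB]
    ext a b
    simp [Matrix.sum_apply, Matrix.mul_apply, pureProj, Matrix.vecMulVec_apply]
  have he : nsq (Pi.single (⟨0, hd⟩ : Fin d) (1 : ℂ)) = 1 := by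
    rw [nsq, Finset.sum_eq_single ⟨0, hd⟩] <;> simp +contextual
  refine ⟨fun i => nsq fun n => star (B i n), fun i => unitize _ fun n => star (B i n),
    fun i => nsq_nonneg _, ?_, fun i => nsq_unitize he _, ?_⟩
  · rw [hsum, Matrix.trace_sum] at htr
    simp only [trace_pureProj] at htr
    exact_mod_cast htr
  · simpa only [nsq_smul_pureProj_unitize] using hsum

lemma le_convexRoof {d : ℕ} (hd : 1 ≤ d) {Fpure : (Fin d → ℂ) → ℝ}
    {ρ : Matrix (Fin d) (Fin d) ℂ} (hρ : IsDensityMatrix ρ) {r : ℝ}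
    (h : ∀ (m : ℕ) (q : Fin m → ℝ) (ψ : Fin m → Fin d → ℂ), (∀ i, 0 ≤ q i) →
      (∀ i, nsq (ψ i) = 1) → ρ = ∑ i, q i • pureProj (ψ i) → r ≤ ∑ i, q i * Fpure (ψ i)) :
    r ≤ convexRoof Fpure ρ := by
  apply le_csInf
  · obtain ⟨q, ψ, hq, hq1, hψ, hρ⟩ := hρ.exists_decomposition hd
    exact ⟨_, d, q, ψ, hq, hq1, hψ, hρ, rfl⟩
  · rintro _ ⟨m, q, ψ, hq, -, hψ, hρ, rfl⟩
    exact h m q ψ hq hψ hρ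

lemma IsPureEnsembleMonotone.sum_unitize_le {d : ℕ} {Fpure : (Fin d → ℂ) → ℝ}
    (hmono : IsPureEnsembleMonotone Fpure) {ψ : Fin d → ℂ} (hψ : nsq ψ = 1)
    {m : ℕ} {K : Fin m → Matrix (Fin d) (Fin d) ℂ} (hK : ∀ j, IsNumberShift (K j))
    (hKsum : ∑ j, (K j)ᴴ * K j = 1) :
    ∑ j, nsq ((K j).mulVec ψ) * Fpure (unitize ψ ((K j).mulVec ψ)) ≤ Fpure ψ := by
  refine le_trans (le_of_eq ?_) (hmono ψ hψ m K hK hKsum)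
  rw [Finset.sum_filter]
  refine Finset.sum_congr rfl fun j _ => ?_
  split_ifs with h
  · rw [unitize, if_pos h]
  · rw [le_antisymm (not_lt.mp h) (nsq_nonneg _), zero_mul]

lemma conj_sum_smul_pureProj {d m : ℕ} (K : Matrix (Fin d) (Fin d) ℂ) (q : Fin m → ℝ)
    (ψ : Fin m → Fin d → ℂ) :
    K * (∑ i, q i • pureProj (ψ i)) * Kᴴ = ∑ i, q i • pureProj (K.mulVec (ψ i)) := by
  simp only [Matrix.mul_sum, Matrix.sum_mul, Matrix.mul_smul, Matrix.smul_mul,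
    mul_pureProj_mul_conjTranspose]

lemma outProb_sum_smul_pureProj {d mJ mX m : ℕ} (K : Fin mJ → Matrix (Fin d) (Fin d) ℂ)
    (part : Fin mJ → Fin mX) (q : Fin m → ℝ) (ψ : Fin m → Fin d → ℂ) (x : Fin mX) :
    outProb K part (∑ i, q i • pureProj (ψ i)) x =
      ∑ j with part j = x, ∑ i, q i * nsq ((K j).mulVec (ψ i)) := by
  simp [outProb, conj_sum_smul_pureProj, Matrix.trace_sum, Matrix.trace_smul, trace_pureProj]

lemma outProb_mul_convexRoof_outState_le {d mJ mX m : ℕ} {Fpure : (Fin d → ℂ) → ℝ}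
    (hF0 : ∀ ψ : Fin d → ℂ, nsq ψ = 1 → 0 ≤ Fpure ψ)
    (K : Fin mJ → Matrix (Fin d) (Fin d) ℂ) (part : Fin mJ → Fin mX)
    {q : Fin m → ℝ} {ψ : Fin m → Fin d → ℂ} (hq : ∀ i, 0 ≤ q i) (hψ : ∀ i, nsq (ψ i) = 1)
    {x : Fin mX} (hx : 0 < outProb K part (∑ i, q i • pureProj (ψ i)) x) :
    outProb K part (∑ i, q i • pureProj (ψ i)) x *
        convexRoof Fpure (outState K part (∑ i, q i • pureProj (ψ i)) x) ≤
      ∑ j with part j = x, ∑ i,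
        q i * (nsq ((K j).mulVec (ψ i)) * Fpure (unitize (ψ i) ((K j).mulVec (ψ i)))) := by
  have hprob := outProb_sum_smul_pureProj K part q ψ x
  have hstate : outState K part (∑ i, q i • pureProj (ψ i)) x =
      (outProb K part (∑ i, q i • pureProj (ψ i)) x)⁻¹ •
        ∑ j with part j = x, ∑ i, q i • pureProj ((K j).mulVec (ψ i)) := by
    simp only [outState, conj_sum_smul_pureProj]
  set p := outProb K part (∑ i, q i • pureProj (ψ i)) x
  let w : Fin mJ × Fin m → ℝ := fun a =>
    if part a.1 = x then p⁻¹ * (q a.2 * nsq ((K a.1).mulVec (ψ a.2))) else 0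
  have hle := convexRoof_le_sum hF0 (q := w)
    (ψ := fun a => unitize (ψ a.2) ((K a.1).mulVec (ψ a.2)))
    (ρ := outState K part (∑ i, q i • pureProj (ψ i)) x) ?_ ?_ (fun a => nsq_unitize (hψ _) _) ?_
  · refine (mul_le_mul_of_nonneg_left hle hx.le).trans_eq ?_
    simp only [w, Fintype.sum_prod_type, Finset.sum_filter, Finset.mul_sum]
    refine Finset.sum_congr rfl fun j _ => ?_
    split_ifs
    · refine Finset.sum_congr rfl fun i _ => ?_
      field_simp
    · simp
  · intro a
    simp only [w]
    split_ifs
    · exact mul_nonneg (inv_nonneg.mpr hx.le) (mul_nonneg (hq _) (nsq_nonneg _))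
    · rfl
  · rw [← inv_mul_cancel₀ hx.ne']
    conv_rhs => enter [2]; rw [hprob]
    simp only [w, Fintype.sum_prod_type, Finset.sum_filter, Finset.mul_sum]
    refine Finset.sum_congr rfl fun j _ => ?_
    split_ifs <;> simp [Finset.mul_sum]
  · rw [hstate]
    simp only [w, Fintype.sum_prod_type, Finset.sum_filter, Finset.smul_sum]
    refine Finset.sum_congr rfl fun j _ => ?_
    split_ifs
    · simp only [Finset.smul_sum, ← smul_smul, nsq_smul_pureProj_unitize]
    · simp

/-- if `Fpure` is a pure-state ensemble monotone, then its convex-roof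
extension is an ensemble monotone for all states: for every density matrix `ρ`,
every finite family of number-shift Kraus operators `{K j}` with `∑ j, K jᴴ * K j = 1`,
and every partition of the index set (given by the fibers of `part`),
`F(ρ) ≥ ∑_{x : p_x > 0} p_x F(σ_x)`. -/
theorem stmt_1 {d : ℕ} (hd : 1 ≤ d) (Fpure : (Fin d → ℂ) → ℝ)
    (hF0 : ∀ ψ : Fin d → ℂ, nsq ψ = 1 → 0 ≤ Fpure ψ)
    (hmono : IsPureEnsembleMonotone Fpure)
    (ρ : Matrix (Fin d) (Fin d) ℂ) (hρ : IsDensityMatrix ρ)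
    (mJ mX : ℕ) (K : Fin mJ → Matrix (Fin d) (Fin d) ℂ)
    (hK : ∀ j, IsNumberShift (K j))
    (hKsum : ∑ j, (K j)ᴴ * K j = 1)
    (part : Fin mJ → Fin mX) :
    convexRoof Fpure ρ ≥
      ∑ x ∈ Finset.univ.filter (fun x => 0 < outProb K part ρ x),
        outProb K part ρ x * convexRoof Fpure (outState K part ρ x) := by
  refine le_convexRoof hd hρ fun m q ψ hq hψ hdec => ?_
  subst hdec
  calc _ ≤ ∑ x with 0 < outProb K part (∑ i, q i • pureProj (ψ i)) x, ∑ j with part j = x, ∑ i,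
        q i * (nsq ((K j).mulVec (ψ i)) * Fpure (unitize (ψ i) ((K j).mulVec (ψ i)))) :=
        Finset.sum_le_sum fun x hx => outProb_mul_convexRoof_outState_le hF0 K part hq hψ
          (Finset.mem_filter.mp hx).2
    _ ≤ ∑ x, ∑ j with part j = x, ∑ i,
        q i * (nsq ((K j).mulVec (ψ i)) * Fpure (unitize (ψ i) ((K j).mulVec (ψ i)))) :=
        Finset.sum_le_sum_of_subset_of_nonneg (Finset.filter_subset _ _) fun x _ _ =>
          Finset.sum_nonneg fun j _ => Finset.sum_nonneg fun i _ => mul_nonneg (hq i)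
            (mul_nonneg (nsq_nonneg _) (hF0 _ (nsq_unitize (hψ i) _)))
    _ = ∑ i, q i * ∑ j,
        nsq ((K j).mulVec (ψ i)) * Fpure (unitize (ψ i) ((K j).mulVec (ψ i))) := by
        rw [Finset.sum_fiberwise, Finset.sum_comm]
        simp only [Finset.mul_sum]
    _ ≤ _ := Finset.sum_le_sum fun i _ =>
        mul_le_mul_of_nonneg_left (hmono.sum_unitize_le (hψ i) hK hKsum) (hq i)
end
end

section
/- For each k with 2 ≤ k ≤ d, define F_k on pure states of ℂ^d by F_k(ψ) = min{ Σ_{n∈S} λ(ψ)_n : S ⊆ {0,…,d−1}, |S| = d−k+1 } (the sum of the d−k+1 smallest entries of the probability vector λ(ψ), i.e. Σ_{i=k}^{d} λ_i^↓). Then F_k is a pure-state ensemble monotone under U(1)-invariant operations: for every unit vector ψ and every U(1)-invariant pure-state ensemble operation {K_x}, F_k(ψ) ≥ Σ_{x : p_x>0} p_x F_k(K_xψ/‖K_xψ‖), where p_x = ‖K_xψ‖². -/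
open Matrix Finset
open scoped ComplexOrder

noncomputable section

/-- `F_k(ψ)`: the minimum, over subsets `S` of `{0,…,d−1}` of cardinality `d−k+1`, of
`∑_{n ∈ S} |ψ_n|²`; i.e. the sum of the `d−k+1` smallest entries of `λ(ψ)`. -/
def Fk {d : ℕ} (k : ℕ) (ψ : Fin d → ℂ) : ℝ :=
  sInf { r : ℝ | ∃ S : Finset (Fin d), S.card = d - k + 1 ∧ r = ∑ n ∈ S, ‖ψ n‖ ^ 2 }

/-- `F_k ψ` is at most the weight of any set of `d - k + 1` levels. -/
theorem Fk_le_sum {d k : ℕ} (ψ : Fin d → ℂ) {S : Finset (Fin d)} (hS : S.card = d - k + 1) :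
    Fk k ψ ≤ ∑ n ∈ S, ‖ψ n‖ ^ 2 := by
  refine csInf_le ⟨0, ?_⟩ ⟨S, hS, rfl⟩
  rintro r ⟨T, -, rfl⟩
  positivity

/-- A common lower bound for the weights of all sets of `d - k + 1` levels bounds `F_k ψ`. -/
theorem le_Fk {d k : ℕ} (hk : 1 ≤ k) (hkd : k ≤ d) (ψ : Fin d → ℂ) {a : ℝ}
    (h : ∀ S : Finset (Fin d), S.card = d - k + 1 → a ≤ ∑ n ∈ S, ‖ψ n‖ ^ 2) :
    a ≤ Fk k ψ := by
  obtain ⟨S, -, hS⟩ := Finset.exists_subset_card_eq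
    (s := (Finset.univ : Finset (Fin d))) (n := d - k + 1) (by simp; omega)
  refine le_csInf ⟨_, S, hS, rfl⟩ ?_
  rintro r ⟨T, hT, rfl⟩
  exact h T hT

/-- `F_k` is homogeneous of degree two, as an upper bound for the normalized vector. -/
theorem nsq_mul_Fk_normalize_le {d k : ℕ} (v : Fin d → ℂ) (hv : 0 < nsq v)
    {S : Finset (Fin d)} (hS : S.card = d - k + 1) :
    nsq v * Fk k ((Real.sqrt (nsq v))⁻¹ • v) ≤ ∑ n ∈ S, ‖v n‖ ^ 2 := by
  refine (mul_le_mul_of_nonneg_left (Fk_le_sum _ hS) hv.le).trans_eq ?_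
  rw [Finset.mul_sum]
  refine Finset.sum_congr rfl fun n _ => ?_
  rw [Pi.smul_apply, norm_smul, mul_pow, norm_inv, Real.norm_eq_abs, inv_pow, sq_abs,
    Real.sq_sqrt hv.le, mul_inv_cancel_left₀ hv.ne']

/-- A number-shift operator maps populations to populations, without interference. -/
theorem norm_sq_mulVec_of_shift {d : ℕ} {K : Matrix (Fin d) (Fin d) ℂ} {ℓ : ℤ}
    (hK : ∀ m n : Fin d, (m : ℤ) ≠ (n : ℤ) + ℓ → K m n = 0) (ψ : Fin d → ℂ) (m : Fin d) :
    ‖K.mulVec ψ m‖ ^ 2 = ∑ n, ‖K m n‖ ^ 2 * ‖ψ n‖ ^ 2 := by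
  by_cases h : ∃ n : Fin d, (m : ℤ) = (n : ℤ) + ℓ
  · obtain ⟨n, hn⟩ := h
    have hz : ∀ b, b ≠ n → K m b = 0 := fun b hb => hK m b fun hmb => hb (Fin.ext (by omega))
    rw [Matrix.mulVec, dotProduct, Finset.sum_eq_single n, Finset.sum_eq_single n, norm_mul,
      mul_pow]
    all_goals simp +contextual [hz]
  · push Not at h
    have hz : ∀ n, K m n = 0 := fun n => hK m n (h n)
    simp [Matrix.mulVec, dotProduct, hz]

/-- For a number-shift operator `K` and a set `S` of input levels there is an equally large set of
output levels whose weight comes only from `S`. -/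
theorem IsNumberShift.exists_card_eq_sum_le {d : ℕ} {K : Matrix (Fin d) (Fin d) ℂ}
    (hK : IsNumberShift K) (ψ : Fin d → ℂ) (S : Finset (Fin d)) :
    ∃ T : Finset (Fin d), T.card = S.card ∧
      ∑ m ∈ T, ‖K.mulVec ψ m‖ ^ 2 ≤ ∑ n ∈ S, (∑ m, ‖K m n‖ ^ 2) * ‖ψ n‖ ^ 2 := by
  classical
  obtain ⟨ℓ, hK⟩ := hK
  set A : Finset (Fin d) :=
    Finset.univ.filter fun m => ∀ n ∈ Sᶜ, (m : ℤ) ≠ (n : ℤ) + ℓ with hA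
  have hcompl : Aᶜ.card ≤ Sᶜ.card := by
    have hex : ∀ m ∈ Aᶜ, ∃ n ∈ Sᶜ, (m : ℤ) = (n : ℤ) + ℓ := by
      intro m hm
      by_contra! hcon
      exact Finset.mem_compl.1 hm (by simpa [hA] using hcon)
    choose! f hfS hf using hex
    refine Finset.card_le_card_of_injOn f hfS fun a ha b hb hab => Fin.ext ?_
    have h₁ := hf a ha
    have h₂ := hf b hb
    rw [hab] at h₁
    omega
  have hcard : S.card ≤ A.card := by
    have h₁ := Finset.card_add_card_compl A
    have h₂ := Finset.card_add_card_compl S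
    omega
  obtain ⟨T, hTA, hT⟩ := Finset.exists_subset_card_eq hcard
  refine ⟨T, hT, ?_⟩
  calc ∑ m ∈ T, ‖K.mulVec ψ m‖ ^ 2
      = ∑ m ∈ T, ∑ n ∈ S, ‖K m n‖ ^ 2 * ‖ψ n‖ ^ 2 := by
        refine Finset.sum_congr rfl fun m hm => ?_
        rw [norm_sq_mulVec_of_shift hK]
        refine (Finset.sum_subset (Finset.subset_univ S) fun n _ hn => ?_).symm
        have hmA := (Finset.mem_filter.1 (hTA hm)).2 n (Finset.mem_compl.2 hn)
        simp [hK m n hmA]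
    _ ≤ ∑ m, ∑ n ∈ S, ‖K m n‖ ^ 2 * ‖ψ n‖ ^ 2 :=
        Finset.sum_le_sum_of_subset_of_nonneg (Finset.subset_univ T) fun _ _ _ => by positivity
    _ = ∑ n ∈ S, (∑ m, ‖K m n‖ ^ 2) * ‖ψ n‖ ^ 2 := by
        rw [Finset.sum_comm]
        simp only [Finset.sum_mul]

/-- The columns of a complete Kraus family have total squared norm one. -/
theorem sum_sum_norm_sq_eq_one {d m : ℕ} {K : Fin m → Matrix (Fin d) (Fin d) ℂ}
    (hK : ∑ x, (K x)ᴴ * K x = 1) (n : Fin d) : ∑ x, ∑ i, ‖K x i n‖ ^ 2 = 1 := by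
  have h := congrFun (congrFun hK n) n
  simp only [Matrix.sum_apply, Matrix.mul_apply, Matrix.conjTranspose_apply, Matrix.one_apply_eq,
    Complex.star_def, Complex.conj_mul'] at h
  exact_mod_cast h

/-- for `2 ≤ k ≤ d`, the function `F_k` is a pure-state ensemble monotone
under U(1)-invariant operations. -/
theorem stmt_4 {d : ℕ} (k : ℕ) (hk2 : 2 ≤ k) (hkd : k ≤ d) :
    IsPureEnsembleMonotone (Fk (d := d) k) := by
  intro ψ _ m K hshift hK
  refine le_Fk (by omega) hkd ψ fun S hS => ?_
  choose T hTcard hT using fun x => (hshift x).exists_card_eq_sum_le ψ S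
  calc _ ≤ ∑ x ∈ Finset.univ.filter (fun x => 0 < nsq ((K x).mulVec ψ)),
        ∑ n ∈ S, (∑ i, ‖K x i n‖ ^ 2) * ‖ψ n‖ ^ 2 :=
        Finset.sum_le_sum fun x hx => (nsq_mul_Fk_normalize_le _ (Finset.mem_filter.1 hx).2
          ((hTcard x).trans hS)).trans (hT x)
    _ ≤ ∑ x, ∑ n ∈ S, (∑ i, ‖K x i n‖ ^ 2) * ‖ψ n‖ ^ 2 :=
        Finset.sum_le_sum_of_subset_of_nonneg (Finset.filter_subset _ _)
          fun _ _ _ => by positivity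
    _ = ∑ n ∈ S, ‖ψ n‖ ^ 2 := by
        rw [Finset.sum_comm]
        refine Finset.sum_congr rfl fun n _ => ?_
        rw [← Finset.sum_mul, sum_sum_norm_sq_eq_one hK, one_mul]
end
end

section
/- Define the entropy of frameness on pure states of ℂ^d by S_F(ψ) = −Σ_{n=0}^{d−1} λ(ψ)_n · log₂(λ(ψ)_n), with the convention 0·log₂0 = 0. Then S_F is a pure-state ensemble monotone under U(1)-invariant operations: for every unit vector ψ and every U(1)-invariant pure-state ensemble operation {K_x}, S_F(ψ) ≥ Σ_{x : p_x>0} p_x S_F(K_xψ/‖K_xψ‖), where p_x = ‖K_xψ‖². -/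
open Matrix Finset
open scoped ComplexOrder

noncomputable section

/-- The entropy of frameness of a pure state, `S_F(ψ) = −∑ n, |ψ_n|² log₂ |ψ_n|²`
(with `0 · log₂ 0 = 0`, which holds by the convention `Real.logb 2 0 = 0`). -/
def entropyF {d : ℕ} (ψ : Fin d → ℂ) : ℝ :=
  -∑ n, ‖ψ n‖ ^ 2 * Real.logb 2 (‖ψ n‖ ^ 2)

/-- A function vanishing at zero commutes with a sum having at most one nonzero term. -/
theorem map_sum_of_subsingleton_support {ι α β : Type*} [Fintype ι] [AddCommMonoid α]
    [AddCommMonoid β] (h : α → β) (h0 : h 0 = 0) (u : ι → α)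
    (hu : ∀ i j, u i ≠ 0 → u j ≠ 0 → i = j) : h (∑ i, u i) = ∑ i, h (u i) := by
  by_cases hz : ∀ i, u i = 0
  · simp [hz, h0]
  · push Not at hz
    obtain ⟨i, hi⟩ := hz
    have hj : ∀ j, j ≠ i → u j = 0 := fun j hji => by
      by_contra hne
      exact hji (hu j i hne hi)
    rw [Fintype.sum_eq_single i hj, Fintype.sum_eq_single i fun j hji => by rw [hj j hji, h0]]

/-- A number-shift operator permutes the weights `‖K e_n‖² * ‖ψ n‖²` among the output levels,
up to zeros. -/
theorem IsNumberShift.sum_map_normSq_mulVec {d : ℕ} {K : Matrix (Fin d) (Fin d) ℂ}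
    (hK : IsNumberShift K) (ψ : Fin d → ℂ) (g : ℝ → ℝ) (g0 : g 0 = 0) :
    ∑ m, g (‖K.mulVec ψ m‖ ^ 2) = ∑ n, g (∑ m, ‖K m n‖ ^ 2 * ‖ψ n‖ ^ 2) := by
  obtain ⟨l, hl⟩ := hK
  have hrow : ∀ m, g (‖K.mulVec ψ m‖ ^ 2) = ∑ n, g (‖K m n‖ ^ 2 * ‖ψ n‖ ^ 2) := by
    intro m
    have := map_sum_of_subsingleton_support (fun z : ℂ => g (‖z‖ ^ 2)) (by simp [g0])
      (fun n => K m n * ψ n) (fun i j hi hj => by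
        have h1 := not_imp_comm.1 (hl m i) (left_ne_zero_of_mul hi)
        have h2 := not_imp_comm.1 (hl m j) (left_ne_zero_of_mul hj)
        ext
        omega)
    simpa [Matrix.mulVec, dotProduct, mul_pow] using this
  have hcol : ∀ n, g (∑ m, ‖K m n‖ ^ 2 * ‖ψ n‖ ^ 2) = ∑ m, g (‖K m n‖ ^ 2 * ‖ψ n‖ ^ 2) := by
    intro n
    refine map_sum_of_subsingleton_support g g0 _ fun i j hi hj => ?_
    have hi' : K i n ≠ 0 := fun h => hi (by simp [h])
    have hj' : K j n ≠ 0 := fun h => hj (by simp [h])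
    have h1 := not_imp_comm.1 (hl i n) hi'
    have h2 := not_imp_comm.1 (hl j n) hj'
    ext
    omega
  simp_rw [hrow, hcol]
  exact Finset.sum_comm

/-- The columns of a complete Kraus family have squared norms summing to one. -/
theorem sum_sum_normSq_col_eq_one {d k : ℕ} {K : Fin k → Matrix (Fin d) (Fin d) ℂ}
    (hK : ∑ x, (K x)ᴴ * K x = 1) (n : Fin d) : ∑ x, ∑ m, ‖K x m n‖ ^ 2 = 1 := by
  have h := congrFun (congrFun hK n) n
  simp only [Matrix.sum_apply, Matrix.mul_apply, Matrix.conjTranspose_apply,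
    Matrix.one_apply_eq, RCLike.star_def, Complex.conj_mul'] at h
  exact_mod_cast h

/-- Pointwise form of Gibbs' inequality. -/
theorem mul_log_add_mul_log_le {a p q : ℝ} (ha : 0 ≤ a) (hp : a ≤ p) (hq : a ≤ q) :
    a * Real.log p + a * Real.log q + a - p * q ≤ a * Real.log a := by
  rcases ha.eq_or_lt with rfl | ha'
  · simpa using mul_nonneg hp hq
  · have hp' := ha'.trans_le hp
    have hq' := ha'.trans_le hq
    have h := Real.log_le_sub_one_of_pos (div_pos (mul_pos hp' hq') ha')
    rw [Real.log_div (by positivity) ha'.ne', Real.log_mul hp'.ne' hq'.ne'] at h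
    have h2 := mul_le_mul_of_nonneg_left h ha
    have h3 : a * (p * q / a - 1) = p * q - a := by field_simp
    linarith

/-- Subadditivity of the Shannon entropy of a joint distribution. -/
theorem sum_mul_log_marginals_le {ι κ : Type*} [Fintype ι] [Fintype κ] (a : ι → κ → ℝ)
    (ha : ∀ i j, 0 ≤ a i j) (h1 : ∑ i, ∑ j, a i j = 1) :
    ∑ i, (∑ j, a i j) * Real.log (∑ j, a i j) + ∑ j, (∑ i, a i j) * Real.log (∑ i, a i j)
      ≤ ∑ i, ∑ j, a i j * Real.log (a i j) := by
  have hpt : ∀ i j, a i j * Real.log (∑ j, a i j) + a i j * Real.log (∑ i, a i j) + a i j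
      - (∑ j, a i j) * (∑ i, a i j) ≤ a i j * Real.log (a i j) := fun i j =>
    mul_log_add_mul_log_le (ha i j)
      (Finset.single_le_sum (f := fun j => a i j) (fun j _ => ha i j) (Finset.mem_univ j))
      (Finset.single_le_sum (f := fun i => a i j) (fun i _ => ha i j) (Finset.mem_univ i))
  have hsum := Finset.sum_le_sum fun i (_ : i ∈ Finset.univ) =>
    Finset.sum_le_sum fun j (_ : j ∈ Finset.univ) => hpt i j
  have h1' : ∑ j, ∑ i, a i j = 1 := by rw [Finset.sum_comm, h1]
  have hprod : ∑ i, ∑ j, (∑ j, a i j) * (∑ i, a i j) = 1 := by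
    rw [← Finset.sum_mul_sum, h1, h1', one_mul]
  have hq : ∑ i, ∑ j, a i j * Real.log (∑ i, a i j)
      = ∑ j, (∑ i, a i j) * Real.log (∑ i, a i j) := by
    rw [Finset.sum_comm]
    simp_rw [Finset.sum_mul]
  have hp : ∑ i, ∑ j, a i j * Real.log (∑ j, a i j)
      = ∑ i, (∑ j, a i j) * Real.log (∑ j, a i j) := by
    simp_rw [Finset.sum_mul]
  simp only [Finset.sum_sub_distrib, Finset.sum_add_distrib] at hsum
  rw [hprod, hq, hp, h1] at hsum
  linarith

/-- The entropy of frameness in terms of natural logarithms. -/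
theorem entropyF_eq_neg_sum_div {d : ℕ} (ψ : Fin d → ℂ) :
    entropyF ψ = -(∑ n, ‖ψ n‖ ^ 2 * Real.log (‖ψ n‖ ^ 2)) / Real.log 2 := by
  simp only [entropyF, Real.logb, neg_div, Finset.sum_div, mul_div_assoc]

/-- The weighted entropy of a normalized vector in terms of the unnormalized one. -/
theorem nsq_mul_entropyF_normalize {d : ℕ} {v : Fin d → ℂ} (hv : 0 < nsq v) :
    nsq v * entropyF ((Real.sqrt (nsq v))⁻¹ • v)
      = (nsq v * Real.log (nsq v) - ∑ n, ‖v n‖ ^ 2 * Real.log (‖v n‖ ^ 2)) / Real.log 2 := by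
  have hn : ∀ n, ‖((Real.sqrt (nsq v))⁻¹ • v) n‖ ^ 2 = ‖v n‖ ^ 2 / nsq v := by
    intro n
    rw [Pi.smul_apply, norm_smul, mul_pow, norm_inv, Real.norm_of_nonneg (Real.sqrt_nonneg _),
      inv_pow, Real.sq_sqrt hv.le, inv_mul_eq_div]
  have hterm : ∀ n, nsq v * (‖v n‖ ^ 2 / nsq v * Real.log (‖v n‖ ^ 2 / nsq v))
      = ‖v n‖ ^ 2 * Real.log (‖v n‖ ^ 2) - ‖v n‖ ^ 2 * Real.log (nsq v) := by
    intro n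
    rcases eq_or_ne (‖v n‖ ^ 2) 0 with h | h
    · simp [h]
    · rw [Real.log_div h hv.ne']
      field_simp
  rw [entropyF_eq_neg_sum_div, ← mul_div_assoc, mul_neg, Finset.mul_sum]
  simp_rw [hn, hterm]
  rw [Finset.sum_sub_distrib, ← Finset.sum_mul, neg_sub]
  rfl

/-- the entropy of frameness is a pure-state ensemble monotone under
U(1)-invariant operations. -/
theorem stmt_5 {d : ℕ} (hd : 1 ≤ d) :
    IsPureEnsembleMonotone (entropyF (d := d)) := by
  intro ψ hψ k K hshift hK
  set a : Fin k → Fin d → ℝ := fun x n => ∑ m, ‖K x m n‖ ^ 2 * ‖ψ n‖ ^ 2 with ha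
  have ha0 : ∀ x n, 0 ≤ a x n := fun x n => Finset.sum_nonneg fun m _ => by positivity
  have hcol : ∀ n, ∑ x, a x n = ‖ψ n‖ ^ 2 := fun n => by
    simp only [ha, ← Finset.sum_mul, sum_sum_normSq_col_eq_one hK n, one_mul]
  have hrow : ∀ x, nsq ((K x).mulVec ψ) = ∑ n, a x n := fun x =>
    (hshift x).sum_map_normSq_mulVec ψ id rfl
  have hent : ∀ x, ∑ n, ‖(K x).mulVec ψ n‖ ^ 2 * Real.log (‖(K x).mulVec ψ n‖ ^ 2)
      = ∑ n, a x n * Real.log (a x n) := fun x =>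
    (hshift x).sum_map_normSq_mulVec ψ (fun t => t * Real.log t) (by simp)
  have h1 : ∑ x, ∑ n, a x n = 1 := by
    rw [Finset.sum_comm]
    simpa only [hcol, nsq] using hψ
  have hsub := sum_mul_log_marginals_le a ha0 h1
  simp only [hcol] at hsub
  have hout : ∑ x ∈ Finset.univ.filter (fun x => 0 < nsq ((K x).mulVec ψ)),
      nsq ((K x).mulVec ψ) * entropyF ((Real.sqrt (nsq ((K x).mulVec ψ)))⁻¹ • (K x).mulVec ψ)
      = ∑ x, ((∑ n, a x n) * Real.log (∑ n, a x n) - ∑ n, a x n * Real.log (a x n))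
        / Real.log 2 := by
    rw [Finset.sum_filter]
    refine Finset.sum_congr rfl fun x _ => ?_
    split_ifs with h
    · rw [nsq_mul_entropyF_normalize h, hent, hrow]
    · have hz : ∑ n, a x n = 0 :=
        le_antisymm (by rw [← hrow]; exact not_lt.1 h) (Finset.sum_nonneg fun n _ => ha0 x n)
      have hz' : ∀ n, a x n = 0 := fun n =>
        (Finset.sum_eq_zero_iff_of_nonneg fun n _ => ha0 x n).1 hz n (Finset.mem_univ n)
      simp [hz']
  rw [hout, entropyF_eq_neg_sum_div, ← Finset.sum_div, Finset.sum_sub_distrib, ge_iff_le]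
  exact div_le_div_of_nonneg_right (by linarith) (Real.log_pos one_lt_two).le
end
end

section
/- For each k with 2 ≤ k ≤ d, define the concurrence of frameness on pure states of ℂ^d by C_k(ψ) = [ e_k(λ(ψ)) · d^k / binom(d,k) ]^{1/k}, where e_k is the k-th elementary symmetric polynomial in the d entries of the probability vector λ(ψ) (note e_k(1/d,…,1/d) = binom(d,k)/d^k). Then C_k is a pure-state ensemble monotone under U(1)-invariant operations: for every unit vector ψ and every U(1)-invariant pure-state ensemble operation {K_x}, C_k(ψ) ≥ Σ_{x : p_x>0} p_x C_k(K_xψ/‖K_xψ‖), where p_x = ‖K_xψ‖². -/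
open Matrix Finset
open scoped ComplexOrder

noncomputable section

/-- The `k`-th elementary symmetric polynomial of the probability vector `λ(ψ)`. -/
def esymmOf {d : ℕ} (k : ℕ) (ψ : Fin d → ℂ) : ℝ :=
  ∑ S ∈ (Finset.univ : Finset (Fin d)).powersetCard k, ∏ n ∈ S, ‖ψ n‖ ^ 2

/-- The concurrence of frameness
`C_k(ψ) = [e_k(λ(ψ)) · d^k / binom(d,k)]^(1/k)`. -/
def Ck {d : ℕ} (k : ℕ) (ψ : Fin d → ℂ) : ℝ :=
  (esymmOf k ψ * (d : ℝ) ^ k / (Nat.choose d k : ℝ)) ^ ((k : ℝ)⁻¹)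

lemma parallel_sum_mono {a b b' : ℝ} (ha : 0 ≤ a) (hb : 0 ≤ b) (h : b ≤ b') :
    a * b / (a + b) ≤ a * b' / (a + b') := by
  rcases ha.eq_or_lt with rfl | ha
  · simp
  rw [div_le_div_iff₀ (by linarith) (by linarith)]
  nlinarith [mul_nonneg (mul_nonneg ha.le ha.le) (sub_nonneg.2 h)]

lemma parallel_sum_superadd {a b c d : ℝ} (ha : 0 ≤ a) (hb : 0 ≤ b) (hc : 0 ≤ c) (hd : 0 ≤ d) :
    a * b / (a + b) + c * d / (c + d) ≤ (a + c) * (b + d) / (a + c + (b + d)) := by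
  rcases (add_nonneg ha hb).eq_or_lt with h | h
  · have h1 : a = 0 := by linarith
    have h2 : b = 0 := by linarith
    simp [h1, h2]
  rcases (add_nonneg hc hd).eq_or_lt with h' | h'
  · have h1 : c = 0 := by linarith
    have h2 : d = 0 := by linarith
    simp [h1, h2]
  rw [div_add_div _ _ h.ne' h'.ne', div_le_div_iff₀ (by positivity) (by linarith)]
  nlinarith [sq_nonneg (a * d - b * c)]

lemma geom_mean_superadd {t a b c d : ℝ} (ht0 : 0 < t) (ht1 : t < 1) (ha : 0 ≤ a) (hb : 0 ≤ b)
    (hc : 0 ≤ c) (hd : 0 ≤ d) :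
    a ^ t * b ^ (1 - t) + c ^ t * d ^ (1 - t) ≤ (a + c) ^ t * (b + d) ^ (1 - t) := by
  have h1 : 0 < 1 - t := by linarith
  rcases (add_nonneg ha hc).eq_or_lt with h | h
  · have e1 : a = 0 := by linarith
    have e2 : c = 0 := by linarith
    simp [e1, e2, Real.zero_rpow ht0.ne']
  rcases (add_nonneg hb hd).eq_or_lt with h' | h'
  · have e1 : b = 0 := by linarith
    have e2 : d = 0 := by linarith
    simp [e1, e2, Real.zero_rpow h1.ne']
  have k1 := Real.geom_mean_le_arith_mean2_weighted ht0.le h1.le (div_nonneg ha h.le)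
    (div_nonneg hb h'.le) (by ring)
  have k2 := Real.geom_mean_le_arith_mean2_weighted ht0.le h1.le (div_nonneg hc h.le)
    (div_nonneg hd h'.le) (by ring)
  rw [Real.div_rpow ha h.le, Real.div_rpow hb h'.le, div_mul_div_comm] at k1
  rw [Real.div_rpow hc h.le, Real.div_rpow hd h'.le, div_mul_div_comm] at k2
  have hP : 0 < (a + c) ^ t * (b + d) ^ (1 - t) := by positivity
  have e : t * (a / (a + c)) + (1 - t) * (b / (b + d))
      + (t * (c / (a + c)) + (1 - t) * (d / (b + d))) = 1 := by
    field_simp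
    ring
  have k3 := add_le_add k1 k2
  rw [e, ← add_div, div_le_one hP] at k3
  exact k3

/-- The elementary symmetric polynomial of degree `k` in the values `x i`, `i ∈ s`. -/
def esum {ι : Type*} (s : Finset ι) (k : ℕ) (x : ι → ℝ) : ℝ :=
  ∑ S ∈ s.powersetCard k, ∏ i ∈ S, x i

section esum

variable {ι : Type*}

@[simp] lemma esum_zero (s : Finset ι) (x : ι → ℝ) : esum s 0 x = 1 := by
  simp [esum]

lemma esum_nonneg (s : Finset ι) (k : ℕ) {x : ι → ℝ} (hx : ∀ i, 0 ≤ x i) : 0 ≤ esum s k x :=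
  Finset.sum_nonneg fun _ _ => Finset.prod_nonneg fun i _ => hx i

lemma esum_smul (s : Finset ι) (k : ℕ) (c : ℝ) (x : ι → ℝ) :
    esum s k (c • x) = c ^ k * esum s k x := by
  unfold esum
  rw [Finset.mul_sum]
  refine Finset.sum_congr rfl fun S hS => ?_
  simp [Finset.prod_mul_distrib, (Finset.mem_powersetCard.1 hS).2]

lemma esum_univ_comp_equiv [Fintype ι] (σ : Equiv.Perm ι) (k : ℕ) (x : ι → ℝ) :
    esum Finset.univ k (x ∘ σ) = esum Finset.univ k x := by
  unfold esum
  rw [← Finset.esymm_map_val, ← Finset.esymm_map_val, ← Multiset.map_map,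
    Multiset.map_univ_val_equiv]

/-- The ratio of consecutive elementary symmetric polynomials, of degrees `k + 1` and `k`. -/
def esumRatio (s : Finset ι) (k : ℕ) (x : ι → ℝ) : ℝ :=
  esum s (k + 1) x / esum s k x

lemma esumRatio_nonneg (s : Finset ι) (k : ℕ) {x : ι → ℝ} (hx : ∀ i, 0 ≤ x i) :
    0 ≤ esumRatio s k x :=
  div_nonneg (esum_nonneg s _ hx) (esum_nonneg s _ hx)

variable [DecidableEq ι]

lemma esum_insert {a : ι} {s : Finset ι} (ha : a ∉ s) (k : ℕ) (x : ι → ℝ) :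
    esum (insert a s) (k + 1) x = esum s (k + 1) x + x a * esum s k x := by
  unfold esum
  rw [Finset.powersetCard_succ_insert ha, Finset.sum_union, Finset.sum_image, Finset.mul_sum]
  · congr 1
    refine Finset.sum_congr rfl fun S hS => Finset.prod_insert fun h => ?_
    exact ha ((Finset.mem_powersetCard.1 hS).1 h)
  · intro S hS T hT h
    have hS' : a ∉ S := fun h => ha ((Finset.mem_powersetCard.1 hS).1 h)
    have hT' : a ∉ T := fun h => ha ((Finset.mem_powersetCard.1 hT).1 h)
    rw [← Finset.erase_insert hS', ← Finset.erase_insert hT']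
    exact congrArg (fun U => Finset.erase U a) h
  · rw [Finset.disjoint_left]
    intro S hS hS'
    obtain ⟨T, -, rfl⟩ := Finset.mem_image.1 hS'
    exact ha ((Finset.mem_powersetCard.1 hS).1 (Finset.mem_insert_self a T))

lemma esum_eq_erase {a : ι} {s : Finset ι} (ha : a ∈ s) (k : ℕ) (x : ι → ℝ) :
    esum s (k + 1) x = esum (s.erase a) (k + 1) x + x a * esum (s.erase a) k x := by
  conv_lhs => rw [← Finset.insert_erase ha]
  exact esum_insert (Finset.notMem_erase a s) k x

lemma succ_mul_esum (s : Finset ι) (k : ℕ) (x : ι → ℝ) :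
    ((k : ℝ) + 1) * esum s (k + 1) x = ∑ i ∈ s, x i * esum (s.erase i) k x := by
  induction s using Finset.induction_on generalizing k with
  | empty => simp [esum, Finset.powersetCard_eq_empty.2 (show (∅ : Finset ι).card < k + 1 by simp)]
  | insert a s ha ih =>
    rw [Finset.sum_insert ha, Finset.erase_insert ha, esum_insert ha]
    have key : ∀ i ∈ s, (insert a s).erase i = insert a (s.erase i) := fun i hi =>
      Finset.erase_insert_of_ne fun h => ha (h ▸ hi)
    have hna : ∀ i, a ∉ s.erase i := fun i h => ha (Finset.mem_of_mem_erase h)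
    cases k with
    | zero =>
      have := ih 0
      simp only [esum_zero, Nat.cast_zero] at this ⊢
      linarith
    | succ k =>
      have h2 : ∑ i ∈ s, x i * esum ((insert a s).erase i) (k + 1) x
          = ∑ i ∈ s, x i * esum (s.erase i) (k + 1) x
            + x a * ∑ i ∈ s, x i * esum (s.erase i) k x := by
        rw [Finset.mul_sum, ← Finset.sum_add_distrib]
        refine Finset.sum_congr rfl fun i hi => ?_
        rw [key i hi, esum_insert (hna i)]
        ring
      rw [h2, ← ih, ← ih]
      push_cast
      ring

lemma esum_succ_eq_zero {s : Finset ι} {k : ℕ} {x : ι → ℝ} (hx : ∀ i, 0 ≤ x i)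
    (h : esum s k x = 0) : esum s (k + 1) x = 0 := by
  have h1 := succ_mul_esum s k x
  have h2 : ∑ i ∈ s, x i * esum (s.erase i) k x = 0 := by
    refine Finset.sum_eq_zero fun i hi => ?_
    cases k with
    | zero => simp at h
    | succ k =>
      rw [esum_eq_erase hi] at h
      have := esum_nonneg (s.erase i) (k + 1) hx
      have := mul_nonneg (hx i) (esum_nonneg (s.erase i) k hx)
      have : esum (s.erase i) (k + 1) x = 0 := by linarith
      rw [this, mul_zero]
  rw [h2] at h1
  exact (mul_eq_zero.1 h1).resolve_left (by positivity)

lemma esum_succ_eq_ratio_mul (s : Finset ι) (k : ℕ) {x : ι → ℝ} (hx : ∀ i, 0 ≤ x i) :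
    esum s (k + 1) x = esumRatio s k x * esum s k x := by
  by_cases h : esum s k x = 0
  · rw [esum_succ_eq_zero hx h, h, mul_zero]
  · rw [esumRatio, div_mul_cancel₀ _ h]

lemma succ_mul_esumRatio (s : Finset ι) (k : ℕ) {x : ι → ℝ} (hx : ∀ i, 0 ≤ x i) :
    ((k : ℝ) + 2) * esumRatio s (k + 1) x
      = ∑ i ∈ s, x i * esumRatio (s.erase i) k x / (x i + esumRatio (s.erase i) k x) := by
  have h := succ_mul_esum s (k + 1) x
  rw [esumRatio, ← mul_div_assoc]
  have h2 : ((k : ℝ) + 2) = ((k + 1 : ℕ) : ℝ) + 1 := by push_cast; ring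
  rw [h2, h, Finset.sum_div]
  refine Finset.sum_congr rfl fun i hi => ?_
  rw [esum_eq_erase hi, esumRatio]
  by_cases h0 : esum (s.erase i) k x = 0
  · rw [esum_succ_eq_zero hx h0]; simp
  · have e1 : x i + esum (s.erase i) (k + 1) x / esum (s.erase i) k x
        = (esum (s.erase i) (k + 1) x + x i * esum (s.erase i) k x) / esum (s.erase i) k x := by
      field_simp
      ring
    rw [e1, ← mul_div_assoc, div_div_div_cancel_right₀ h0]

lemma esumRatio_superadd (s : Finset ι) (k : ℕ) {x y : ι → ℝ} (hx : ∀ i, 0 ≤ x i)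
    (hy : ∀ i, 0 ≤ y i) :
    esumRatio s k x + esumRatio s k y ≤ esumRatio s k (x + y) := by
  have hxy : ∀ i, 0 ≤ (x + y) i := fun i => add_nonneg (hx i) (hy i)
  induction k generalizing s with
  | zero => simp [esumRatio, esum, Finset.powersetCard_one, Finset.sum_add_distrib]
  | succ k ih =>
    refine le_of_mul_le_mul_left ?_ (by positivity : (0 : ℝ) < (k : ℝ) + 2)
    rw [mul_add, succ_mul_esumRatio s k hx, succ_mul_esumRatio s k hy,
      succ_mul_esumRatio s k hxy, ← Finset.sum_add_distrib]
    refine Finset.sum_le_sum fun i _ => ?_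
    have qx := esumRatio_nonneg (s.erase i) k hx
    have qy := esumRatio_nonneg (s.erase i) k hy
    exact (parallel_sum_superadd (hx i) qx (hy i) qy).trans
      (parallel_sum_mono (hxy i) (add_nonneg qx qy) (ih (s.erase i)))

/-- The **Marcus–Lopes inequality**: the `k`-th root of the `k`-th elementary symmetric
polynomial is superadditive on nonnegative vectors. -/
theorem esum_rpow_superadd (s : Finset ι) {k : ℕ} (hk : 1 ≤ k) {x y : ι → ℝ}
    (hx : ∀ i, 0 ≤ x i) (hy : ∀ i, 0 ≤ y i) :
    esum s k x ^ (k : ℝ)⁻¹ + esum s k y ^ (k : ℝ)⁻¹ ≤ esum s k (x + y) ^ (k : ℝ)⁻¹ := by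
  have hxy : ∀ i, 0 ≤ (x + y) i := fun i => add_nonneg (hx i) (hy i)
  induction k, hk using Nat.le_induction with
  | base => simp [esum, Finset.powersetCard_one, Finset.sum_add_distrib]
  | succ k hk ih =>
    have hk0 : (0 : ℝ) < k := by exact_mod_cast hk
    set t : ℝ := ((k + 1 : ℕ) : ℝ)⁻¹ with ht
    have ht0 : 0 < t := by positivity
    have ht' : 1 - t = (k : ℝ)⁻¹⁻¹ * t := by
      rw [ht]; push_cast; field_simp; ring
    have ht1 : t < 1 := by
      have : 0 < 1 - t := by rw [ht']; positivity
      linarith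
    have key : ∀ z : ι → ℝ, (∀ i, 0 ≤ z i) →
        esum s (k + 1) z ^ t = esumRatio s k z ^ t * (esum s k z ^ (k : ℝ)⁻¹) ^ (1 - t) := by
      intro z hz
      have hez := esum_nonneg s k hz
      rw [esum_succ_eq_ratio_mul s k hz, Real.mul_rpow (esumRatio_nonneg s k hz) hez,
        ← Real.rpow_mul hez, ht', ← mul_assoc, mul_inv_cancel₀ (inv_ne_zero hk0.ne'), one_mul]
    rw [key x hx, key y hy, key _ hxy]
    have qx := esumRatio_nonneg s k hx
    have qy := esumRatio_nonneg s k hy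
    have rx := Real.rpow_nonneg (esum_nonneg s k hx) (k : ℝ)⁻¹
    have ry := Real.rpow_nonneg (esum_nonneg s k hy) (k : ℝ)⁻¹
    refine (geom_mean_superadd ht0 ht1 qx rx qy ry).trans ?_
    exact mul_le_mul
      (Real.rpow_le_rpow (add_nonneg qx qy) (esumRatio_superadd s k hx hy) ht0.le)
      (Real.rpow_le_rpow (add_nonneg rx ry) ih (by linarith))
      (Real.rpow_nonneg (add_nonneg rx ry) _)
      (Real.rpow_nonneg (esumRatio_nonneg s k hxy) _)

theorem sum_esum_rpow_le {κ : Type*} (s : Finset ι) {k : ℕ} (hk : 1 ≤ k) (A : Finset κ)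
    {x : κ → ι → ℝ} (hx : ∀ a i, 0 ≤ x a i) :
    ∑ a ∈ A, esum s k (x a) ^ (k : ℝ)⁻¹ ≤ esum s k (∑ a ∈ A, x a) ^ (k : ℝ)⁻¹ := by
  classical
  induction A using Finset.induction_on with
  | empty => exact Real.rpow_nonneg (esum_nonneg s k fun _ => le_rfl) _
  | insert a A ha ih =>
    rw [Finset.sum_insert ha, Finset.sum_insert ha]
    have hA : ∀ i, 0 ≤ (∑ a ∈ A, x a) i := fun i => by
      rw [Finset.sum_apply]; exact Finset.sum_nonneg fun b _ => hx b i
    have := esum_rpow_superadd s hk (hx a) hA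
    linarith

end esum

lemma IsNumberShift.exists_perm {d : ℕ} {K : Matrix (Fin d) (Fin d) ℂ} (hK : IsNumberShift K) :
    ∃ σ : Equiv.Perm (Fin d), ∀ m n, m ≠ σ n → K m n = 0 := by
  obtain ⟨l, hl⟩ := hK
  rcases Nat.eq_zero_or_pos d with rfl | hd
  · exact ⟨Equiv.refl _, fun m => m.elim0⟩
  have hd' : (0 : ℤ) < d := by exact_mod_cast hd
  have h0 : ∀ a : ℤ, 0 ≤ a % d := fun a => Int.emod_nonneg a hd'.ne'
  have h1 : ∀ a : ℤ, a % d < d := fun a => Int.emod_lt_of_pos a hd'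
  let f : Fin d → Fin d := fun n =>
    ⟨(((n : ℤ) + l) % d).toNat, by have := h0 (n + l); have := h1 (n + l); omega⟩
  have hf : ∀ n, ((f n : ℕ) : ℤ) = ((n : ℤ) + l) % d := fun n => Int.toNat_of_nonneg (h0 _)
  have hm : ∀ n : Fin d, (n : ℤ) % d = n := fun n =>
    Int.emod_eq_of_lt (by positivity) (by exact_mod_cast n.2)
  have hinj : Function.Injective f := by
    intro m n h
    have h2 : ((m : ℤ) + l) % d = ((n : ℤ) + l) % d := by rw [← hf, ← hf, h]
    have h3 : (m : ℤ) % d = (n : ℤ) % d := Int.ModEq.add_right_cancel' l h2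
    rw [hm, hm] at h3
    exact Fin.ext (by exact_mod_cast h3)
  refine ⟨Equiv.ofBijective f (Finite.injective_iff_bijective.1 hinj), fun m n hmn => hl m n ?_⟩
  intro h
  apply hmn
  apply Fin.ext
  have : ((m : ℕ) : ℤ) = (f n : ℕ) := by rw [hf, ← h, hm]
  exact_mod_cast this

/-- Applying a number-shift operator rescales the probability vector entrywise by the squared
column norms, up to a permutation of the entries. -/
lemma IsNumberShift.esymmOf_mulVec {d : ℕ} {K : Matrix (Fin d) (Fin d) ℂ} (hK : IsNumberShift K)
    (k : ℕ) (ψ : Fin d → ℂ) :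
    esymmOf k (K.mulVec ψ)
      = esum Finset.univ k (fun n => (∑ m, ‖K m n‖ ^ 2) * ‖ψ n‖ ^ 2) := by
  obtain ⟨σ, hσ⟩ := hK.exists_perm
  have h : (fun n => (∑ m, ‖K m n‖ ^ 2) * ‖ψ n‖ ^ 2)
      = (fun m => ‖K.mulVec ψ m‖ ^ 2) ∘ σ := by
    funext n
    have h1 : ∑ m, ‖K m n‖ ^ 2 = ‖K (σ n) n‖ ^ 2 :=
      Finset.sum_eq_single _ (fun m _ hm => by simp [hσ m n hm]) (by simp)
    have h2 : K.mulVec ψ (σ n) = K (σ n) n * ψ n := by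
      rw [Matrix.mulVec, dotProduct]
      exact Finset.sum_eq_single n
        (fun j _ hj => by simp [hσ (σ n) j fun e => hj (σ.injective e).symm]) (by simp)
    simp [h1, h2, mul_pow]
  rw [h, esum_univ_comp_equiv]
  rfl

lemma esymmOf_nonneg {d : ℕ} (k : ℕ) (ψ : Fin d → ℂ) : 0 ≤ esymmOf k ψ :=
  esum_nonneg Finset.univ k fun _ => sq_nonneg _

lemma Ck_eq {d : ℕ} (k : ℕ) (ψ : Fin d → ℂ) :
    Ck k ψ = esymmOf k ψ ^ (k : ℝ)⁻¹ * ((d : ℝ) ^ k / (Nat.choose d k : ℝ)) ^ (k : ℝ)⁻¹ := by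
  rw [Ck, mul_div_assoc, Real.mul_rpow (esymmOf_nonneg k ψ) (by positivity)]

lemma mul_Ck_smul {d : ℕ} {k : ℕ} (hk : k ≠ 0) {p : ℝ} (hp : 0 < p) (φ : Fin d → ℂ) :
    p * Ck k ((Real.sqrt p)⁻¹ • φ) = Ck k φ := by
  have h : esymmOf k ((Real.sqrt p)⁻¹ • φ) = p⁻¹ ^ k * esymmOf k φ := by
    refine Eq.trans ?_ (esum_smul Finset.univ k p⁻¹ fun n => ‖φ n‖ ^ 2)
    refine congrArg (esum Finset.univ k) (funext fun n => ?_)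
    simp [mul_pow, Real.sq_sqrt hp.le]
  rw [Ck_eq, Ck_eq, h, Real.mul_rpow (by positivity) (esymmOf_nonneg k φ),
    Real.pow_rpow_inv_natCast (by positivity) hk, ← mul_assoc, ← mul_assoc,
    mul_inv_cancel₀ hp.ne', one_mul]

lemma sum_sq_norm_col_eq_one {d m : ℕ} {K : Fin m → Matrix (Fin d) (Fin d) ℂ}
    (hK : ∑ x, (K x)ᴴ * K x = 1) (n : Fin d) : ∑ x, ∑ j, ‖K x j n‖ ^ 2 = 1 := by
  have h := congrFun (congrFun hK n) n
  rw [Matrix.sum_apply] at h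
  simp only [Matrix.mul_apply, Matrix.conjTranspose_apply, Matrix.one_apply_eq, Complex.star_def,
    Complex.conj_mul'] at h
  exact_mod_cast h

/-- for `2 ≤ k ≤ d`, the concurrence of frameness `C_k` is a pure-state
ensemble monotone under U(1)-invariant operations. -/
theorem stmt_6 {d : ℕ} (k : ℕ) (hk2 : 2 ≤ k) (hkd : k ≤ d) :
    IsPureEnsembleMonotone (Ck (d := d) k) := by
  intro ψ _ m K hshift hK
  have hk : k ≠ 0 := by omega
  set w : Fin m → Fin d → ℝ := fun x n => (∑ j, ‖K x j n‖ ^ 2) * ‖ψ n‖ ^ 2 with hw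
  have hw0 : ∀ x n, 0 ≤ w x n := fun x n => by positivity
  have hsum : ∑ x, w x = fun n => ‖ψ n‖ ^ 2 := by
    funext n
    rw [Finset.sum_apply, hw, ← Finset.sum_mul, sum_sq_norm_col_eq_one hK, one_mul]
  have hmain := sum_esum_rpow_le Finset.univ (by omega : 1 ≤ k) Finset.univ hw0
  rw [hsum] at hmain
  calc ∑ x ∈ Finset.univ.filter (fun x => 0 < nsq ((K x).mulVec ψ)),
        nsq ((K x).mulVec ψ) * Ck k ((Real.sqrt (nsq ((K x).mulVec ψ)))⁻¹ • (K x).mulVec ψ)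
      = ∑ x ∈ Finset.univ.filter (fun x => 0 < nsq ((K x).mulVec ψ)),
          Ck k ((K x).mulVec ψ) :=
        Finset.sum_congr rfl fun x hx => mul_Ck_smul hk (Finset.mem_filter.1 hx).2 _
    _ ≤ ∑ x, Ck k ((K x).mulVec ψ) :=
        Finset.sum_le_sum_of_subset_of_nonneg (Finset.filter_subset _ _) fun x _ _ => by
          rw [Ck_eq]
          have := esymmOf_nonneg k ((K x).mulVec ψ)
          positivity
    _ = (∑ x, esum Finset.univ k (w x) ^ (k : ℝ)⁻¹)
          * ((d : ℝ) ^ k / (Nat.choose d k : ℝ)) ^ (k : ℝ)⁻¹ := by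
        rw [Finset.sum_mul]
        exact Finset.sum_congr rfl fun x _ => by rw [Ck_eq, (hshift x).esymmOf_mulVec]
    _ ≤ Ck k ψ := by
        rw [Ck_eq]
        exact mul_le_mul_of_nonneg_right hmain (by positivity)
end
end

section
/- Let 𝓕 : [0,∞) → [0,∞) be convex and nondecreasing, and define F_pure on qubit pure states by F_pure(ψ) = 𝓕(C₂(ψ)) = 𝓕(2|ψ₀||ψ₁|). Then the convex-roof extension F of F_pure satisfies F(ρ) = 𝓕(C₂(ρ)) for every 2×2 density matrix ρ, where C₂(ρ) is the convex-roof extension of the pure-state concurrence. -/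
open Matrix Finset
open scoped ComplexOrder

noncomputable section

/-- The flip (Pauli X) operator on a qubit. -/
def Xmat : Matrix (Fin 2) (Fin 2) ℂ := !![0, 1; 1, 0]

/-- `ρ̃ = X ρ* X`, with `ρ*` the entrywise complex conjugate of `ρ`. -/
def rhoTilde (ρ : Matrix (Fin 2) (Fin 2) ℂ) : Matrix (Fin 2) (Fin 2) ℂ :=
  Xmat * ρ.map (starRingEnd ℂ) * Xmat

/-- The concurrence of a qubit pure state, `C₂(ψ) = 2|ψ₀||ψ₁|`. -/
def Cpure (ψ : Fin 2 → ℂ) : ℝ := 2 * ‖ψ 0‖ * ‖ψ 1‖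

lemma nsq_two (ψ : Fin 2 → ℂ) : nsq ψ = ‖ψ 0‖ ^ 2 + ‖ψ 1‖ ^ 2 := by
  simp [nsq, Fin.sum_univ_two]

/-- The off-diagonal entry of a mixture bounds its average concurrence from below. -/
lemma two_mul_norm_le_sum_Cpure {m : ℕ} {q : Fin m → ℝ} {ψ : Fin m → Fin 2 → ℂ}
    (hq : ∀ i, 0 ≤ q i) :
    2 * ‖(∑ i, q i • pureProj (ψ i)) 0 1‖ ≤ ∑ i, q i * Cpure (ψ i) := by
  rw [Matrix.sum_apply]
  calc 2 * ‖∑ i, (q i • pureProj (ψ i)) 0 1‖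
      ≤ 2 * ∑ i, ‖(q i • pureProj (ψ i)) 0 1‖ := by gcongr; exact norm_sum_le _ _
    _ = ∑ i, q i * Cpure (ψ i) := by
      rw [Finset.mul_sum]
      refine Finset.sum_congr rfl fun i _ => ?_
      simp only [Matrix.smul_apply, pureProj, Matrix.vecMulVec_apply, Pi.star_apply, norm_smul,
        norm_mul, norm_star, Real.norm_of_nonneg (hq i), Cpure]
      ring

/-- A qubit density matrix is a mixture of two pure states of concurrence `2 * ‖ρ 0 1‖`. -/
lemma exists_two_pure_decomposition {ρ : Matrix (Fin 2) (Fin 2) ℂ} (hρ : IsDensityMatrix ρ) :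
    ∃ (q : Fin 2 → ℝ) (ψ : Fin 2 → Fin 2 → ℂ), (∀ i, 0 ≤ q i) ∧ (∑ i, q i = 1) ∧
      (∀ i, nsq (ψ i) = 1) ∧ ρ = ∑ i, q i • pureProj (ψ i) ∧
      ∀ i, Cpure (ψ i) = 2 * ‖ρ 0 1‖ := by
  obtain ⟨hpos, htr⟩ := hρ
  have h10 : ρ 1 0 = star (ρ 0 1) := (hpos.isHermitian.apply 1 0).symm
  have h00 : ρ 0 0 = ((ρ 0 0).re : ℂ) :=
    (Complex.conj_eq_iff_re.mp (hpos.isHermitian.apply 0 0)).symm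
  have h11 : ρ 1 1 = 1 - ((ρ 0 0).re : ℂ) := by
    rw [Matrix.trace_fin_two] at htr
    rw [← h00, ← htr]; ring
  set p := (ρ 0 0).re
  set c := ‖ρ 0 1‖ with hc
  have hdet : c ^ 2 ≤ p * (1 - p) := by
    have h := hpos.det_nonneg
    rw [Matrix.det_fin_two, h10, h00, h11] at h
    have e : (ρ 0 1) * star (ρ 0 1) = ((c ^ 2 : ℝ) : ℂ) := by
      rw [hc]; simpa using Complex.mul_conj' (ρ 0 1)
    rw [e] at h
    have h' : (0 : ℂ) ≤ ((p * (1 - p) - c ^ 2 : ℝ) : ℂ) := by push_cast at h ⊢; exact h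
    linarith [Complex.zero_le_real.mp h']
  have hc0 : 0 ≤ c := norm_nonneg _
  obtain ⟨u, hu, hcu⟩ : ∃ u : ℂ, ‖u‖ = 1 ∧ ρ 0 1 = c * u :=
    ⟨Complex.exp ((ρ 0 1).arg * Complex.I), Complex.norm_exp_ofReal_mul_I _,
      (Complex.norm_mul_exp_arg_mul_I _).symm⟩
  have huu : u * star u = 1 := by
    simpa [hu] using Complex.mul_conj' u
  obtain ⟨s, hs0, hs⟩ : ∃ s : ℝ, 0 ≤ s ∧ s ^ 2 = 1 - 4 * c ^ 2 :=
    ⟨√(1 - 4 * c ^ 2), Real.sqrt_nonneg _, Real.sq_sqrt (by nlinarith [sq_nonneg (2 * p - 1)])⟩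
  have hs1 : s ≤ 1 := by nlinarith
  have hps : |2 * p - 1| ≤ s := abs_le_of_sq_le_sq (by nlinarith) hs0
  obtain ⟨t, ht0, ht1, ht⟩ : ∃ t : ℝ, 0 ≤ t ∧ t ≤ 1 ∧ 2 * p - 1 = (2 * t - 1) * s := by
    obtain ⟨hl, hr⟩ := abs_le.mp hps
    rcases hs0.eq_or_lt with h | h
    · exact ⟨0, le_rfl, zero_le_one, by rw [← h] at hl hr ⊢; linarith⟩
    · refine ⟨(2 * p - 1 + s) / (2 * s), by apply div_nonneg <;> linarith, ?_, ?_⟩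
      · rw [div_le_one (by linarith)]; linarith
      · field_simp; ring
  obtain ⟨a, ha0, ha⟩ : ∃ a : ℝ, 0 ≤ a ∧ a ^ 2 = (1 + s) / 2 :=
    ⟨√((1 + s) / 2), Real.sqrt_nonneg _, Real.sq_sqrt (by linarith)⟩
  obtain ⟨b, hb0, hb⟩ : ∃ b : ℝ, 0 ≤ b ∧ b ^ 2 = (1 - s) / 2 :=
    ⟨√((1 - s) / 2), Real.sqrt_nonneg _, Real.sq_sqrt (by linarith)⟩
  have hab : a * b = c := by
    rw [← sq_eq_sq₀ (mul_nonneg ha0 hb0) hc0, mul_pow, ha, hb]; linarith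
  have hna : ‖(a : ℂ)‖ = a := by simp [abs_of_nonneg ha0]
  have hnb : ‖(b : ℂ)‖ = b := by simp [abs_of_nonneg hb0]
  have hp : t * a ^ 2 + (1 - t) * b ^ 2 = p := by rw [ha, hb]; linarith
  have hp' : t * b ^ 2 + (1 - t) * a ^ 2 = 1 - p := by rw [ha, hb]; linarith
  have habC : (a : ℂ) * b = c := by exact_mod_cast hab
  have hpC : (t : ℂ) * a ^ 2 + (1 - t) * b ^ 2 = p := by exact_mod_cast hp
  have hpC' : (t : ℂ) * b ^ 2 + (1 - t) * a ^ 2 = 1 - p := by exact_mod_cast hp'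
  have hsa : star (a : ℂ) = a := Complex.conj_ofReal a
  have hsb : star (b : ℂ) = b := Complex.conj_ofReal b
  have hsc : star (c : ℂ) = c := Complex.conj_ofReal c
  refine ⟨![t, 1 - t], ![![a * u, b], ![b * u, a]], ?_, ?_, ?_, ?_, ?_⟩
  · intro i; fin_cases i <;> simp [ht0, ht1]
  · simp [Fin.sum_univ_two]
  · intro i; fin_cases i <;> simp [nsq_two, hu, ha, hb] <;> ring
  · ext i j
    fin_cases i <;> fin_cases j <;>
      simp only [Fin.sum_univ_two, Matrix.add_apply, Matrix.smul_apply, pureProj,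
        Matrix.vecMulVec_apply, Pi.star_apply, Complex.real_smul, Fin.zero_eta, Fin.mk_one,
        Matrix.cons_val_zero, Matrix.cons_val_one, star_mul', hsa, hsb, h00, h10, h11, hcu, hsc,
        Complex.ofReal_sub, Complex.ofReal_one]
    · linear_combination -hpC - (t * a ^ 2 + (1 - t) * b ^ 2 : ℂ) * huu
    · linear_combination -u * habC
    · linear_combination -star u * habC
    · linear_combination -hpC'
  · intro i
    fin_cases i <;> simp [Cpure, hu, abs_of_nonneg ha0, abs_of_nonneg hb0] <;> linarith

/-- The convex roof of a convex nondecreasing function of the concurrence, in closed form. -/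
lemma convexRoof_comp_Cpure {G : ℝ → ℝ} (hconv : ConvexOn ℝ (Set.Ici (0 : ℝ)) G)
    (hmono : MonotoneOn G (Set.Ici 0)) {ρ : Matrix (Fin 2) (Fin 2) ℂ} (hρ : IsDensityMatrix ρ) :
    convexRoof (fun ψ => G (Cpure ψ)) ρ = G (2 * ‖ρ 0 1‖) := by
  have hC (ψ : Fin 2 → ℂ) : 0 ≤ Cpure ψ := by unfold Cpure; positivity
  refine IsLeast.csInf_eq ⟨?_, ?_⟩
  · obtain ⟨q, ψ, hq, hsum, hn, hd, hCψ⟩ := exists_two_pure_decomposition hρ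
    exact ⟨2, q, ψ, hq, hsum, hn, hd, by simp only [hCψ, ← Finset.sum_mul, hsum, one_mul]⟩
  · rintro r ⟨m, q, ψ, hq, hsum, -, hd, rfl⟩
    have hle : 2 * ‖ρ 0 1‖ ≤ ∑ i, q i * Cpure (ψ i) := hd ▸ two_mul_norm_le_sum_Cpure hq
    have h0 : 0 ≤ 2 * ‖ρ 0 1‖ := by positivity
    refine (hmono h0 (h0.trans hle) hle).trans ?_
    simpa only [smul_eq_mul] using
      hconv.map_sum_le (t := Finset.univ) (fun i _ => hq i) hsum fun i _ => hC (ψ i)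

/-- for any convex, nondecreasing `𝓕 : [0,∞) → [0,∞)`, the convex-roof
extension of `ψ ↦ 𝓕(C₂(ψ))` equals `𝓕` applied to the convex-roof extension of `C₂`. -/
theorem stmt_10 (F : ℝ → ℝ)
    (hF0 : ∀ x : ℝ, 0 ≤ x → 0 ≤ F x)
    (hconv : ConvexOn ℝ (Set.Ici (0 : ℝ)) F)
    (hmono : ∀ x y : ℝ, 0 ≤ x → x ≤ y → F x ≤ F y)
    (ρ : Matrix (Fin 2) (Fin 2) ℂ) (hρ : IsDensityMatrix ρ) :
    convexRoof (fun ψ => F (Cpure ψ)) ρ = F (convexRoof Cpure ρ) := by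
  have hid : convexRoof Cpure ρ = 2 * ‖ρ 0 1‖ :=
    convexRoof_comp_Cpure (convexOn_id (convex_Ici 0)) monotoneOn_id hρ
  rw [hid]
  exact convexRoof_comp_Cpure hconv (fun x hx y _ hxy => hmono x y hx hxy) hρ
end
end

section
/- Let α ∈ ℝ, p ∈ [0,1], φ₁ = (cos(α/2), sin(α/2)), φ₂ = (−sin(α/2), cos(α/2)) ∈ ℂ², and ρ = p|φ₁⟩⟨φ₁| + (1−p)|φ₂⟩⟨φ₂|. Then the concurrence of frameness of ρ is C₂(ρ) = |(1−2p)·sin α|. -/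
open Matrix Finset
open scoped ComplexOrder

noncomputable section

/-- The pure state `φ₁ = (cos(α/2), sin(α/2))`. -/
def phi1 (α : ℝ) : Fin 2 → ℂ := ![((Real.cos (α / 2) : ℝ) : ℂ), ((Real.sin (α / 2) : ℝ) : ℂ)]

/-- The pure state `φ₂ = (−sin(α/2), cos(α/2))`. -/
def phi2 (α : ℝ) : Fin 2 → ℂ := ![(-(Real.sin (α / 2) : ℝ) : ℂ), ((Real.cos (α / 2) : ℝ) : ℂ)]

/-- The qubit state `ρ = p|φ₁⟩⟨φ₁| + (1−p)|φ₂⟩⟨φ₂|`. -/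
def rhoAlpha (α p : ℝ) : Matrix (Fin 2) (Fin 2) ℂ :=
  p • pureProj (phi1 α) + (1 - p) • pureProj (phi2 α)

theorem pureProj_ofReal (a b : ℝ) :
    pureProj ![(a : ℂ), (b : ℂ)] =
      !![((a ^ 2 : ℝ) : ℂ), ((a * b : ℝ) : ℂ); ((a * b : ℝ) : ℂ), ((b ^ 2 : ℝ) : ℂ)] := by
  ext i j
  fin_cases i <;> fin_cases j <;> simp [pureProj, vecMulVec_apply] <;> ring

/-- A real qubit state, written through the Bloch coordinates `x` and `z`. -/
theorem rhoAlpha_eq (α p : ℝ) :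
    rhoAlpha α p =
      !![(((1 + (2 * p - 1) * Real.cos α) / 2 : ℝ) : ℂ), (((2 * p - 1) * Real.sin α / 2 : ℝ) : ℂ);
        (((2 * p - 1) * Real.sin α / 2 : ℝ) : ℂ),
        (((1 - (2 * p - 1) * Real.cos α) / 2 : ℝ) : ℂ)] := by
  have hs : Real.sin α = 2 * Real.sin (α / 2) * Real.cos (α / 2) := by
    rw [← Real.sin_two_mul]; congr 1; ring
  have hc : Real.cos α = Real.cos (α / 2) ^ 2 - Real.sin (α / 2) ^ 2 := by
    rw [← Real.cos_two_mul']; congr 1; ring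
  have h1 := Real.sin_sq_add_cos_sq (α / 2)
  have h2 : phi2 α = ![((-Real.sin (α / 2) : ℝ) : ℂ), ((Real.cos (α / 2) : ℝ) : ℂ)] := by
    simp [phi2]
  rw [rhoAlpha, h2, phi1, pureProj_ofReal, pureProj_ofReal, hs, hc]
  generalize Real.sin (α / 2) = s at *
  generalize Real.cos (α / 2) = c at *
  ext i j
  fin_cases i <;> fin_cases j <;>
    simp only [Matrix.add_apply, Matrix.smul_apply, Complex.real_smul, Fin.zero_eta, Fin.mk_one,
      Matrix.of_apply, Matrix.cons_val', Matrix.cons_val_zero, Matrix.cons_val_one,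
      Matrix.cons_val_fin_one] <;>
    norm_cast <;> first | ring1 | linear_combination (1 / 2 : ℝ) * h1

theorem Cpure_eq_norm_pureProj (ψ : Fin 2 → ℂ) : Cpure ψ = 2 * ‖pureProj ψ 0 1‖ := by
  simp [Cpure, pureProj, vecMulVec_apply, mul_assoc]

/-- The pure-state concurrence averaged over a decomposition is at least twice the modulus of the
off-diagonal entry. -/
theorem two_mul_norm_offDiag_le {m : ℕ} {q : Fin m → ℝ} (hq : ∀ i, 0 ≤ q i)
    (ψ : Fin m → Fin 2 → ℂ) :
    2 * ‖(∑ i, q i • pureProj (ψ i)) 0 1‖ ≤ ∑ i, q i * Cpure (ψ i) := by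
  rw [Matrix.sum_apply]
  calc 2 * ‖∑ i, (q i • pureProj (ψ i)) 0 1‖
      ≤ 2 * ∑ i, ‖(q i • pureProj (ψ i)) 0 1‖ := by gcongr; exact norm_sum_le _ _
    _ = ∑ i, q i * Cpure (ψ i) := by
      rw [Finset.mul_sum]
      refine Finset.sum_congr rfl fun i _ => ?_
      rw [Cpure_eq_norm_pureProj, Matrix.smul_apply, norm_smul, Real.norm_of_nonneg (hq i)]
      ring

/-- A real qubit state is a mixture of two real pure states with the same off-diagonal entry. -/
theorem exists_decomposition_of_bloch {x z : ℝ} (h : x ^ 2 + z ^ 2 ≤ 1) :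
    ∃ (q : Fin 2 → ℝ) (ψ : Fin 2 → Fin 2 → ℂ),
      (∀ i, 0 ≤ q i) ∧ (∑ i, q i = 1) ∧ (∀ i, nsq (ψ i) = 1) ∧
      !![(((1 + z) / 2 : ℝ) : ℂ), ((x / 2 : ℝ) : ℂ); ((x / 2 : ℝ) : ℂ), (((1 - z) / 2 : ℝ) : ℂ)] =
        ∑ i, q i • pureProj (ψ i) ∧ |x| = ∑ i, q i * Cpure (ψ i) := by
  obtain ⟨c, s, w, hcs, hx, hw, hw0, hw2⟩ : ∃ c s w : ℝ,
      c ^ 2 + s ^ 2 = 1 ∧ x = 2 * c * s ∧ w = c ^ 2 - s ^ 2 ∧ 0 ≤ w ∧ w ^ 2 = 1 - x ^ 2 := by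
    have ht : 2 * (Real.arcsin x / 2) = Real.arcsin x := by ring
    refine ⟨Real.cos (Real.arcsin x / 2), Real.sin (Real.arcsin x / 2),
      Real.cos (Real.arcsin x), Real.cos_sq_add_sin_sq _, ?_, ?_, Real.cos_arcsin_nonneg x, ?_⟩
    · rw [mul_right_comm, ← Real.sin_two_mul, ht,
        Real.sin_arcsin (by nlinarith) (by nlinarith)]
    · rw [← Real.cos_two_mul', ht]
    · rw [Real.cos_arcsin, Real.sq_sqrt (by nlinarith)]
  have hzw : |z| ≤ w := abs_le_of_sq_le_sq (by linarith) hw0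
  have hdiv : z / w * w = z := by
    rcases eq_or_ne w 0 with h0 | h0
    · have : z = 0 := abs_nonpos_iff.mp (h0 ▸ hzw)
      simp [this]
    · exact div_mul_cancel₀ z h0
  have hr : |z / w| ≤ 1 := by
    rw [abs_div, abs_of_nonneg hw0]
    exact div_le_one_of_le₀ hzw hw0
  generalize z / w = r at hdiv hr
  obtain ⟨hr1, hr2⟩ := abs_le.mp hr
  have hC : 2 * |c| * |s| = |x| := by rw [hx, abs_mul, abs_mul, abs_two]
  refine ⟨![(1 + r) / 2, (1 - r) / 2], ![![(c : ℂ), (s : ℂ)], ![(s : ℂ), (c : ℂ)]], ?_, ?_, ?_,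
    ?_, ?_⟩
  · rw [Fin.forall_fin_two]
    constructor <;> simp <;> linarith
  · simp; ring
  · rw [Fin.forall_fin_two]
    constructor <;> simp [nsq] <;> linarith
  · rw [Fin.sum_univ_two]
    simp only [Matrix.cons_val_zero, Matrix.cons_val_one, pureProj_ofReal]
    ext i j
    fin_cases i <;> fin_cases j <;>
      simp only [Matrix.add_apply, Matrix.smul_apply, Complex.real_smul, Fin.zero_eta, Fin.mk_one,
        Matrix.of_apply, Matrix.cons_val', Matrix.cons_val_zero, Matrix.cons_val_one,
        Matrix.cons_val_fin_one] <;>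
      norm_cast
    · linear_combination (-1 / 2 : ℝ) * hcs - (1 / 2 : ℝ) * hdiv + (r / 2) * hw
    · linear_combination (1 / 2 : ℝ) * hx
    · linear_combination (1 / 2 : ℝ) * hx
    · linear_combination (-1 / 2 : ℝ) * hcs + (1 / 2 : ℝ) * hdiv - (r / 2) * hw
  · simp only [Fin.sum_univ_two, Cpure, Matrix.cons_val_zero, Matrix.cons_val_one,
      Complex.norm_real, Real.norm_eq_abs]
    linear_combination -hC

/-- the concurrence of frameness of
`ρ = p|φ₁⟩⟨φ₁| + (1−p)|φ₂⟩⟨φ₂|` is `|(1−2p)·sin α|`. -/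
theorem stmt_12 (α p : ℝ) (hp0 : 0 ≤ p) (hp1 : p ≤ 1) :
    convexRoof Cpure (rhoAlpha α p) = |(1 - 2 * p) * Real.sin α| := by
  have hx : |(1 - 2 * p) * Real.sin α| = |(2 * p - 1) * Real.sin α| := by
    rw [← abs_neg]; congr 1; ring
  have hbloch : ((2 * p - 1) * Real.sin α) ^ 2 + ((2 * p - 1) * Real.cos α) ^ 2 ≤ 1 := by
    rw [mul_pow, mul_pow, ← mul_add, Real.sin_sq_add_cos_sq]
    nlinarith
  rw [hx]
  refine IsLeast.csInf_eq ⟨?_, ?_⟩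
  · rw [rhoAlpha_eq]
    exact ⟨2, exists_decomposition_of_bloch hbloch⟩
  · rintro r ⟨m, q, ψ, hq, -, -, hρ, rfl⟩
    refine le_trans (le_of_eq ?_) (two_mul_norm_offDiag_le hq ψ)
    rw [← hρ, rhoAlpha_eq]
    simp only [Matrix.of_apply, Matrix.cons_val', Matrix.cons_val_zero, Matrix.cons_val_one,
      Matrix.cons_val_fin_one, Complex.norm_real, Real.norm_eq_abs, abs_div, abs_two]
    ring
end
end
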